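/- arXiv:1912.05113 — 2 statements merged into one kernel-verified Lean document; each statement's English description precedes it below -/
import Mathlib

section
/- If N is a multiple of 4 and M = N/2, then for every φ ∈ (0,1), min_{1 ≤ k ≤ M} χ_k(φ) = χ_M(φ) = ((1−φ)/(1+φ))². -/
open Real Matrix Finset Set

noncomputable section

/-- `Ψ_k(φ) = (1-φ²)/(1 - 2 φ cos(θ k) + φ²)` with `θ = 2π/N`. -/
def Psi (N k : ℕ) (φ : ℝ) : ℝ :=
  (1 - φ ^ 2) / (1 - 2 * φ * Real.cos (2 * Real.pi / N * k) + φ ^ 2)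

/-- `Ψ̄(φ) = (1+φ^M)/(1-φ^M)`. -/
def PsiBar (M : ℕ) (φ : ℝ) : ℝ := (1 + φ ^ M) / (1 - φ ^ M)

/-- Eigenvalues `χ_k(φ)` of the row-normalized racetrack proximity matrix. -/
def chi (N M k : ℕ) (φ : ℝ) : ℝ :=
  if Even k then Psi N k φ * Psi N M φ
  else Psi N k φ * Psi N M φ * PsiBar M φ

theorem Psi_ge (N k : ℕ) (φ : ℝ) (h0 : 0 < φ) (h1 : φ < 1) :
    (1 - φ) / (1 + φ) ≤ Psi N k φ := by
  unfold Psi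
  have hc := Real.neg_one_le_cos (2 * Real.pi / N * k)
  have hc' := Real.cos_le_one (2 * Real.pi / N * k)
  generalize Real.cos (2 * Real.pi / N * k) = c at *
  have hd : 0 < 1 - 2 * φ * c + φ ^ 2 := by
    nlinarith [mul_nonneg h0.le (sub_nonneg.2 hc'), pow_pos (sub_pos.2 h1) 2]
  rw [div_le_div_iff₀ (by linarith) hd]
  have h : 0 ≤ (1 - φ) * (2 * φ * (c + 1)) :=
    mul_nonneg (by linarith) (mul_nonneg (by linarith) (by linarith))
  nlinarith

theorem Psi_M (N M : ℕ) (hN : N = 2 * M) (hM : 2 ≤ M) (φ : ℝ) (h0 : 0 < φ) :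
    Psi N M φ = (1 - φ) / (1 + φ) := by
  have hM0 : (M : ℝ) ≠ 0 := by
    have : M ≠ 0 := by omega
    exact_mod_cast this
  have h : 2 * Real.pi / (N : ℝ) * M = Real.pi := by
    rw [hN]; push_cast; field_simp
  unfold Psi
  rw [h, Real.cos_pi]
  have : 1 + φ ≠ 0 := by linarith
  have h2 : 1 - 2 * φ * (-1) + φ ^ 2 = (1 + φ) ^ 2 := by ring
  rw [h2]
  field_simp
  ring

/-- If `N` is a multiple of `4` and `M = N/2`, then for every `φ ∈ (0,1)` the
minimum of `{χ_k(φ) : 1 ≤ k ≤ M}` is `χ_M(φ) = ((1−φ)/(1+φ))²`. -/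
theorem chi_min_multiple_of_four (N M : ℕ) (hN4 : 4 ∣ N) (hM : M = N / 2)
    (hM2 : 2 ≤ M) (φ : ℝ) (hφ : φ ∈ Set.Ioo (0 : ℝ) 1) :
    (∀ k, 1 ≤ k → k ≤ M → chi N M M φ ≤ chi N M k φ) ∧
    chi N M M φ = ((1 - φ) / (1 + φ)) ^ 2 := by
  obtain ⟨h0, h1⟩ := hφ
  have hN : N = 2 * M := by omega
  have hMe : Even M := by
    rw [even_iff_two_dvd]; omega
  have hPM := Psi_M N M hN hM2 φ h0
  have hp : 0 < (1 - φ) / (1 + φ) := div_pos (by linarith) (by linarith)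
  have hval : chi N M M φ = ((1 - φ) / (1 + φ)) ^ 2 := by
    unfold chi
    rw [if_pos hMe, hPM, sq]
  refine ⟨fun k _ _ => ?_, hval⟩
  have hk := Psi_ge N k φ h0 h1
  have hmul := mul_le_mul_of_nonneg_right hk hp.le
  rw [hval, sq]
  unfold chi
  rw [hPM]
  split_ifs with he
  · exact hmul
  · have hq0 : 0 < φ ^ M := pow_pos h0 M
    have hq1 : φ ^ M < 1 := pow_lt_one₀ h0.le h1 (by omega)
    have hb : 1 ≤ PsiBar M φ := by
      unfold PsiBar
      rw [le_div_iff₀ (by linarith)]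
      linarith
    have hpos : 0 < (1 - φ) / (1 + φ) * ((1 - φ) / (1 + φ)) := mul_pos hp hp
    exact hmul.trans (le_mul_of_one_le_right (hpos.le.trans hmul) hb)
end
end

section
/- (Eigenvalues of the comparative-statics matrix.) Let N = 2M with M ≥ 1, φ ∈ (0,1), and let D̄(φ) be the row-normalized racetrack proximity matrix with eigenvalues χ_k(φ). Let p, q, r, s be real polynomials such that q(D̄(φ)) and s(D̄(φ)) are invertible, and set V := q(D̄(φ))⁻¹p(D̄(φ)) and A := s(D̄(φ))⁻¹r(D̄(φ)). Let C := I − (1/N)𝟙𝟙ᵀ be the centering matrix, and assume p(χ_k(φ)) ≠ 0 for every k = 1,…,M. Then the matrix (I−C) − CV is invertible, and for any constant c > 0 the matrix X := c((I−C) − CV)⁻¹ C A satisfies: for every vector z with D̄(φ)z = χz and 𝟙ᵀz = 0, one has X z = −c·(r(χ)q(χ))/(s(χ)p(χ))·z, and likewise (C X C) z = −c·(r(χ)q(χ))/(s(χ)p(χ))·z; i.e., each eigenvector of D̄(φ) orthogonal to 𝟙 is an eigenvector of X with eigenvalue −c·Gn(χ)/G(χ), where G(χ) = p(χ)/q(χ)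 and Gn(χ) = r(χ)/s(χ). -/
open Real Matrix Finset Set Polynomial

noncomputable section

/-- Racetrack distance between regions `i` and `j` on the circle with `N` regions. -/
def rdist (N : ℕ) (i j : Fin N) : ℕ :=
  min (max ((i : ℕ) - (j : ℕ)) ((j : ℕ) - (i : ℕ)))
      (N - max ((i : ℕ) - (j : ℕ)) ((j : ℕ) - (i : ℕ)))

/-- Racetrack proximity matrix `D(φ)` with entries `φ ^ ℓ_{ij}`. -/
def Dmat (N : ℕ) (φ : ℝ) : Matrix (Fin N) (Fin N) ℝ :=
  Matrix.of fun i j => φ ^ rdist N i j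

/-- Common row sum `S(φ) = (1+φ)(1-φ^M)/(1-φ)`. -/
def Srow (M : ℕ) (φ : ℝ) : ℝ := (1 + φ) * (1 - φ ^ M) / (1 - φ)

/-- Row-normalized proximity matrix `D̄(φ) = S(φ)⁻¹ D(φ)`. -/
def Dbar (N M : ℕ) (φ : ℝ) : Matrix (Fin N) (Fin N) ℝ := (Srow M φ)⁻¹ • Dmat N φ

/-- Rational matrix function `q(D̄(φ))⁻¹ p(D̄(φ))` of the row-normalized
racetrack proximity matrix. -/
def ratMat (N M : ℕ) (φ : ℝ) (p q : Polynomial ℝ) : Matrix (Fin N) (Fin N) ℝ :=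
  (Polynomial.aeval (Dbar N M φ) q)⁻¹ * Polynomial.aeval (Dbar N M φ) p

/-- Centering matrix `C = I − (1/N) 𝟙𝟙ᵀ`. -/
def Cmat (N : ℕ) : Matrix (Fin N) (Fin N) ℝ :=
  1 - ((N : ℝ)⁻¹) • Matrix.of (fun _ _ : Fin N => (1 : ℝ))

/-- Comparative-statics matrix `X = c ((I−C) − C V)⁻¹ C A` with `V = G(D̄)` and
`A = Gn(D̄)`. -/
def Xmat (N M : ℕ) (φ : ℝ) (p q r s : Polynomial ℝ) (c : ℝ) :
    Matrix (Fin N) (Fin N) ℝ :=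
  c • (((1 - Cmat N) - Cmat N * ratMat N M φ p q)⁻¹ * Cmat N * ratMat N M φ r s)

lemma aux_aeval_mulVec {n : ℕ} (D : Matrix (Fin n) (Fin n) ℝ) (χ : ℝ) (z : Fin n → ℝ)
    (h : D.mulVec z = χ • z) (p : Polynomial ℝ) :
    (Polynomial.aeval D p).mulVec z = p.eval χ • z := by
  have hpow : ∀ k : ℕ, (D ^ k).mulVec z = χ ^ k • z := by
    intro k
    induction k with
    | zero => simp
    | succ k ih => rw [pow_succ, ← Matrix.mulVec_mulVec, h, Matrix.mulVec_smul, ih, smul_smul,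
        pow_succ, mul_comm]
  induction p using Polynomial.induction_on' with
  | add p q hp hq => simp [Matrix.add_mulVec, hp, hq, add_smul]
  | monomial k a =>
    rw [Polynomial.aeval_monomial, Polynomial.eval_monomial, ← Algebra.smul_def,
      Matrix.smul_mulVec, hpow, smul_smul]

lemma aux_aeval_functional {n : ℕ} {E : Type*} [AddCommGroup E] [Module ℝ E]
    (D : Matrix (Fin n) (Fin n) ℝ) (χ : ℝ)
    (F : (Fin n → ℝ) →ₗ[ℝ] E) (h : ∀ x, F (D.mulVec x) = χ • F x) (p : Polynomial ℝ)
    (x : Fin n → ℝ) :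
    F ((Polynomial.aeval D p).mulVec x) = p.eval χ • F x := by
  have hpow : ∀ k : ℕ, ∀ x, F ((D ^ k).mulVec x) = χ ^ k • F x := by
    intro k
    induction k with
    | zero => simp
    | succ k ih =>
      intro x
      rw [pow_succ, ← Matrix.mulVec_mulVec, ih, h, smul_smul, pow_succ]
  induction p using Polynomial.induction_on' with
  | add p q hp hq => simp [Matrix.add_mulVec, hp, hq, add_smul]
  | monomial k a =>
    rw [Polynomial.aeval_monomial, Polynomial.eval_monomial, ← Algebra.smul_def,
      Matrix.smul_mulVec, map_smul, hpow, smul_smul]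

lemma aux_rdist_symm (N : ℕ) (i j : Fin N) : rdist N i j = rdist N j i := by
  unfold rdist; rw [max_comm]

lemma aux_rdist_add (N : ℕ) [NeZero N] (j m : Fin N) :
    rdist N (j + m) j = min (m : ℕ) (N - m) := by
  unfold rdist
  rw [Fin.val_add]
  have hj := j.isLt
  have hm := m.isLt
  rcases lt_or_ge ((j : ℕ) + m) N with h | h
  · rw [Nat.mod_eq_of_lt h]; omega
  · rw [Nat.mod_eq_sub_mod h, Nat.mod_eq_of_lt (by omega)]; omega

lemma aux_sum_half (M : ℕ) (φ u v ε : ℂ) (huv : u * v = 1) (hu : u ^ M = ε) (hε : ε * ε = 1) :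
    (∑ m ∈ Finset.range (2 * M), u ^ m * φ ^ (min m (2 * M - m))) * (1 - φ * (u + v) + φ ^ 2)
      = (1 - ε * φ ^ M) * (1 - φ ^ 2) := by
  have hv : v ^ M = ε := by
    have : u ^ M * v ^ M = 1 := by rw [← mul_pow, huv, one_pow]
    rw [hu] at this
    calc v ^ M = (ε * ε) * v ^ M := by rw [hε, one_mul]
      _ = ε * (ε * v ^ M) := by ring
      _ = ε := by rw [this, mul_one]
  rw [two_mul, Finset.sum_range_add]
  have h1 : ∑ m ∈ Finset.range M, u ^ m * φ ^ (min m (M + M - m))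
      = ∑ m ∈ Finset.range M, (u * φ) ^ m := by
    apply Finset.sum_congr rfl
    intro m hm
    rw [Finset.mem_range] at hm
    rw [min_eq_left (by omega), mul_pow]
  have h2 : ∑ m ∈ Finset.range M, u ^ (M + m) * φ ^ (min (M + m) (M + M - (M + m)))
      = v * φ * ∑ m ∈ Finset.range M, (v * φ) ^ m := by
    rw [Finset.mul_sum, ← Finset.sum_range_reflect]
    apply Finset.sum_congr rfl
    intro m hm
    rw [Finset.mem_range] at hm
    rw [min_eq_right (by omega)]
    have e1 : M + M - (M + (M - 1 - m)) = m + 1 := by omega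
    rw [e1, ← pow_succ', mul_pow]
    congr 1
    have h3 : u ^ (M + (M - 1 - m)) * u ^ (m + 1) = 1 := by
      rw [← pow_add]
      have : M + (M - 1 - m) + (m + 1) = M + M := by omega
      rw [this, pow_add, hu, hε]
    have h4 : u ^ (m + 1) * v ^ (m + 1) = 1 := by rw [← mul_pow, huv, one_pow]
    calc u ^ (M + (M - 1 - m)) = u ^ (M + (M - 1 - m)) * (u ^ (m + 1) * v ^ (m + 1)) := by
          rw [h4, mul_one]
      _ = (u ^ (M + (M - 1 - m)) * u ^ (m + 1)) * v ^ (m + 1) := by ring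
      _ = v ^ (m + 1) := by rw [h3, one_mul]
  rw [h1, h2]
  have g1 := geom_sum_mul (u * φ) M
  have g2 := geom_sum_mul (v * φ) M
  rw [mul_pow, hu] at g1
  rw [mul_pow, hv] at g2
  have e : 1 - φ * (u + v) + φ ^ 2 = (u * φ - 1) * (v * φ - 1) := by
    linear_combination (-φ ^ 2) * huv
  rw [e]
  linear_combination (v * φ - 1) * g1 + v * φ * (u * φ - 1) * g2 + φ ^ 2 * (ε * φ ^ M - 1) * huv

lemma aux_sum_circ (M : ℕ) (hM : 1 ≤ M) (φ u v ε : ℂ) (huv : u * v = 1) (hu : u ^ M = ε)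
    (hε : ε * ε = 1) (j : Fin (2 * M)) :
    (∑ i : Fin (2 * M), u ^ (i : ℕ) * φ ^ rdist (2 * M) i j) * (1 - φ * (u + v) + φ ^ 2)
      = (1 - ε * φ ^ M) * (1 - φ ^ 2) * u ^ (j : ℕ) := by
  have : NeZero (2 * M) := ⟨by omega⟩
  have h2 : u ^ (2 * M) = 1 := by rw [two_mul, pow_add, hu, hε]
  rw [← Equiv.sum_comp (Equiv.addLeft j)]
  have h : ∀ m : Fin (2 * M), u ^ ((Equiv.addLeft j m : Fin (2 * M)) : ℕ) *
      φ ^ rdist (2 * M) (Equiv.addLeft j m) j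
      = u ^ (j : ℕ) * (u ^ (m : ℕ) * φ ^ (min (m : ℕ) (2 * M - m))) := by
    intro m
    rw [Equiv.coe_addLeft, aux_rdist_add, Fin.val_add, ← pow_eq_pow_mod _ h2, pow_add, mul_assoc]
  rw [Finset.sum_congr rfl (fun m _ => h m), ← Finset.mul_sum,
    Fin.sum_univ_eq_sum_range (fun m => u ^ m * φ ^ (min m (2 * M - m))), mul_assoc,
    aux_sum_half M φ u v ε huv hu hε, mul_comm]

/-- Fourier functional. -/
def auxF (N : ℕ) (u : ℂ) : (Fin N → ℝ) →ₗ[ℝ] ℂ where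
  toFun x := ∑ i : Fin N, u ^ (i : ℕ) * (x i : ℂ)
  map_add' x y := by simp [mul_add, Finset.sum_add_distrib]
  map_smul' a x := by
    simp only [Pi.smul_apply, smul_eq_mul, Complex.ofReal_mul, RingHom.id_apply,
      Complex.real_smul, Finset.mul_sum]
    exact Finset.sum_congr rfl fun i _ => by ring

/-- The k-th root. -/
def auxU (N k : ℕ) : ℂ := Complex.exp (2 * Real.pi * Complex.I / N) ^ k

lemma aux_cos_pos (φ : ℝ) (hφ : φ ∈ Set.Ioo (0 : ℝ) 1) (t : ℝ) :
    0 < 1 - 2 * φ * Real.cos t + φ ^ 2 := by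
  obtain ⟨h0, h1⟩ := hφ
  nlinarith [Real.cos_le_one t, mul_nonneg h0.le (sub_nonneg.2 (Real.cos_le_one t)),
    sq_pos_of_pos (sub_pos.2 h1)]

lemma aux_fourier (M : ℕ) (hM : 1 ≤ M) (φ : ℝ) (hφ : φ ∈ Set.Ioo (0 : ℝ) 1) (k : ℕ)
    (x : Fin (2 * M) → ℝ) :
    auxF (2 * M) (auxU (2 * M) k) ((Dbar (2 * M) M φ).mulVec x)
      = chi (2 * M) M k φ • auxF (2 * M) (auxU (2 * M) k) x := by
  have hM0 : (M : ℝ) ≠ 0 := by positivity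
  have hM0c : (M : ℂ) ≠ 0 := by exact_mod_cast hM0
  set t : ℝ := 2 * Real.pi / ((2 * M : ℕ) : ℝ) * k with ht
  have hU : auxU (2 * M) k = Complex.exp (t * Complex.I) := by
    unfold auxU
    rw [← Complex.exp_nat_mul, ht]
    congr 1
    push_cast
    ring
  set u := auxU (2 * M) k with hu
  set v := Complex.exp (-(t * Complex.I)) with hv
  have huv : u * v = 1 := by rw [hU, hv, ← Complex.exp_add]; simp
  have hsum : u + v = ((2 * Real.cos t : ℝ) : ℂ) := by
    rw [hU, hv]; push_cast; rw [Complex.two_cos, neg_mul]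
  have huM : u ^ M = (((-1 : ℝ) ^ k : ℝ) : ℂ) := by
    rw [hu, auxU, ← pow_mul, mul_comm k M, pow_mul, ← Complex.exp_nat_mul]
    have : (M : ℂ) * (2 * Real.pi * Complex.I / ((2 * M : ℕ) : ℂ)) = Real.pi * Complex.I := by
      push_cast; field_simp
    rw [this, Complex.exp_pi_mul_I]; push_cast; rfl
  have hε : (((-1 : ℝ) ^ k : ℝ) : ℂ) * (((-1 : ℝ) ^ k : ℝ) : ℂ) = 1 := by
    rw [← Complex.ofReal_mul, ← mul_pow]; simp
  have hpos := aux_cos_pos φ hφ t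
  have h0 := hφ.1
  have h1 := hφ.2
  have hφM : φ ^ M < 1 := pow_lt_one₀ h0.le h1 (by omega)
  have hchi : chi (2 * M) M k φ =
      (Srow M φ)⁻¹ * ((1 - (-1) ^ k * φ ^ M) * (1 - φ ^ 2) / (1 - 2 * φ * Real.cos t + φ ^ 2)) := by
    have hPM : Psi (2 * M) M φ = (1 - φ) / (1 + φ) := by
      unfold Psi
      have : 2 * Real.pi / ((2 * M : ℕ) : ℝ) * M = Real.pi := by push_cast; field_simp
      rw [this, Real.cos_pi]
      have : 1 - 2 * φ * -1 + φ ^ 2 = (1 + φ) ^ 2 := by ring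
      rw [this]
      have : 1 + φ ≠ 0 := by positivity
      field_simp
      ring
    unfold chi
    rw [hPM]
    unfold Psi PsiBar Srow
    rw [← ht]
    have a1 : 1 + φ ≠ 0 := by positivity
    have a2 : 1 - φ ≠ 0 := by linarith
    have a3 : 1 - φ ^ M ≠ 0 := by linarith
    have a4 := hpos.ne'
    generalize 1 - 2 * φ * Real.cos t + φ ^ 2 = w at a4 ⊢
    generalize φ ^ M = y at a3 ⊢
    split_ifs with hk
    · rw [hk.neg_one_pow]; field_simp
    · rw [(Nat.not_even_iff_odd.1 hk).neg_one_pow]; field_simp; ring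
  have key : ∀ j : Fin (2 * M), ∑ i : Fin (2 * M), u ^ (i : ℕ) * ((Dbar (2 * M) M φ i j : ℝ) : ℂ)
      = (chi (2 * M) M k φ : ℂ) * u ^ (j : ℕ) := by
    intro j
    have hc := aux_sum_circ M hM (φ : ℂ) u v _ huv huM hε j
    have hw : 1 - (φ : ℂ) * (u + v) + (φ : ℂ) ^ 2 =
        ((1 - 2 * φ * Real.cos t + φ ^ 2 : ℝ) : ℂ) := by rw [hsum]; push_cast; ring
    rw [hw] at hc
    have hwne : ((1 - 2 * φ * Real.cos t + φ ^ 2 : ℝ) : ℂ) ≠ 0 := by exact_mod_cast hpos.ne'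
    rw [← eq_div_iff hwne] at hc
    have : ∑ i : Fin (2 * M), u ^ (i : ℕ) * ((Dbar (2 * M) M φ i j : ℝ) : ℂ)
        = (((Srow M φ)⁻¹ : ℝ) : ℂ) *
          ∑ i : Fin (2 * M), u ^ (i : ℕ) * (φ : ℂ) ^ rdist (2 * M) i j := by
      rw [Finset.mul_sum]
      refine Finset.sum_congr rfl fun i _ => ?_
      simp only [Dbar, Dmat, Matrix.smul_apply, Matrix.of_apply, smul_eq_mul]
      push_cast
      ring
    rw [this, hc, hchi]
    push_cast
    ring
  change ∑ i : Fin (2 * M), u ^ (i : ℕ) * (((Dbar (2 * M) M φ).mulVec x i : ℝ) : ℂ)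
    = chi (2 * M) M k φ • ∑ i : Fin (2 * M), u ^ (i : ℕ) * (x i : ℂ)
  simp only [Matrix.mulVec, dotProduct, Complex.ofReal_sum, Complex.ofReal_mul, Finset.mul_sum,
    Complex.real_smul]
  rw [Finset.sum_comm]
  refine Finset.sum_congr rfl fun j _ => ?_
  rw [← mul_assoc, ← key j, Finset.sum_mul]
  exact Finset.sum_congr rfl fun i _ => by ring

lemma aux_chi_zero (M : ℕ) (hM : 1 ≤ M) (φ : ℝ) (hφ : φ ∈ Set.Ioo (0 : ℝ) 1) :
    chi (2 * M) M 0 φ = 1 := by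
  have hM0 : (M : ℝ) ≠ 0 := by positivity
  have h0 := hφ.1
  have h1 := hφ.2
  have a1 : 1 + φ ≠ 0 := by positivity
  have a2 : 1 - φ ≠ 0 := by linarith
  unfold chi Psi
  have : 2 * Real.pi / ((2 * M : ℕ) : ℝ) * M = Real.pi := by push_cast; field_simp
  rw [this, Real.cos_pi]
  have e1 : 1 - 2 * φ * -1 + φ ^ 2 = (1 + φ) ^ 2 := by ring
  have e2 : 1 - 2 * φ * 1 + φ ^ 2 = (1 - φ) ^ 2 := by ring
  rw [e1]
  simp only [Nat.cast_zero, mul_zero, Real.cos_zero, Even.zero, if_true, e2]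
  field_simp
  ring

/-- Sum functional. -/
def auxS (N : ℕ) : (Fin N → ℝ) →ₗ[ℝ] ℝ where
  toFun x := ∑ i, x i
  map_add' x y := by simp [Finset.sum_add_distrib]
  map_smul' a x := by simp [Finset.mul_sum]

lemma aux_sum_Dbar (M : ℕ) (hM : 1 ≤ M) (φ : ℝ) (hφ : φ ∈ Set.Ioo (0 : ℝ) 1)
    (x : Fin (2 * M) → ℝ) :
    auxS (2 * M) ((Dbar (2 * M) M φ).mulVec x) = (1 : ℝ) • auxS (2 * M) x := by
  have h := aux_fourier M hM φ hφ 0 x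
  rw [aux_chi_zero M hM φ hφ] at h
  simp only [auxF, auxU, pow_zero, LinearMap.coe_mk, AddHom.coe_mk, one_pow, one_mul,
    one_smul] at h
  simp only [auxS, LinearMap.coe_mk, AddHom.coe_mk, one_smul]
  exact_mod_cast h

lemma aux_Dbar_one (M : ℕ) (hM : 1 ≤ M) (φ : ℝ) (hφ : φ ∈ Set.Ioo (0 : ℝ) 1) :
    (Dbar (2 * M) M φ).mulVec (fun _ => 1) = (1 : ℝ) • (fun _ => 1) := by
  ext j
  have h := aux_sum_Dbar M hM φ hφ (Pi.single j 1)
  simp only [auxS, LinearMap.coe_mk, AddHom.coe_mk, Matrix.mulVec_single_one, one_smul,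
    Finset.sum_pi_single', Finset.mem_univ, if_true, Matrix.col_apply] at h
  simp only [Matrix.mulVec, dotProduct, mul_one, one_smul]
  rw [← h]
  refine Finset.sum_congr rfl fun i _ => ?_
  simp only [Dbar, Dmat, Matrix.smul_apply, Matrix.of_apply, aux_rdist_symm _ j i]

lemma aux_inj (M : ℕ) (hM : 1 ≤ M) (φ : ℝ) (hφ : φ ∈ Set.Ioo (0 : ℝ) 1) (p : Polynomial ℝ)
    (hp : ∀ k, 1 ≤ k → k ≤ M → p.eval (chi (2 * M) M k φ) ≠ 0)
    (x : Fin (2 * M) → ℝ) (hx : ∑ i, x i = 0)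
    (h : (Polynomial.aeval (Dbar (2 * M) M φ) p).mulVec x = 0) : x = 0 := by
  have hF : ∀ k, k ≤ M → auxF (2 * M) (auxU (2 * M) k) x = 0 := by
    intro k hk
    rcases Nat.eq_zero_or_pos k with rfl | hk0
    · simp only [auxF, auxU, pow_zero, LinearMap.coe_mk, AddHom.coe_mk, one_pow, one_mul]
      exact_mod_cast hx
    · have := aux_aeval_functional _ _ _ (aux_fourier M hM φ hφ k) p x
      rw [h, map_zero] at this
      exact (smul_eq_zero.1 this.symm).resolve_left (hp k hk0 hk)
  have hprim := Complex.isPrimitiveRoot_exp (2 * M) (by omega)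
  set ω := Complex.exp (2 * Real.pi * Complex.I / ((2 * M : ℕ) : ℂ)) with hω
  have hconj : (starRingEnd ℂ) ω * ω = 1 := by
    have e : (2 * Real.pi * Complex.I / ((2 * M : ℕ) : ℂ))
        = ((2 * Real.pi / ((2 * M : ℕ) : ℝ) : ℝ) : ℂ) * Complex.I := by
      push_cast; ring
    rw [hω, e, ← Complex.exp_conj, ← Complex.exp_add, map_mul, Complex.conj_ofReal,
      Complex.conj_I, mul_neg, neg_add_cancel, Complex.exp_zero]
  have hF' : ∀ k, k < 2 * M → auxF (2 * M) (auxU (2 * M) k) x = 0 := by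
    intro k hk
    rcases le_or_gt k M with h | h
    · exact hF k h
    · have h3 := hF (2 * M - k) (by omega)
      have h4 : auxU (2 * M) k = (starRingEnd ℂ) (auxU (2 * M) (2 * M - k)) := by
        unfold auxU
        rw [← hω, map_pow]
        have e1 : ω ^ k * ω ^ (2 * M - k) = 1 := by
          rw [← pow_add, show k + (2 * M - k) = 2 * M by omega, hprim.pow_eq_one]
        have e2 : (starRingEnd ℂ) ω ^ (2 * M - k) * ω ^ (2 * M - k) = 1 := by
          rw [← mul_pow, hconj, one_pow]
        exact mul_right_cancel₀ (right_ne_zero_of_mul_eq_one e1) (e1.trans e2.symm)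
      have h5 := congrArg (starRingEnd ℂ) h3
      rw [map_zero] at h5
      rw [← h5, h4]
      simp [auxF]
  have hdet : (Matrix.vandermonde (fun k : Fin (2 * M) => ω ^ (k : ℕ))).det ≠ 0 := by
    rw [Matrix.det_vandermonde_ne_zero_iff]
    intro a b hab
    exact Fin.ext (hprim.pow_inj a.isLt b.isLt hab)
  have hz := Matrix.eq_zero_of_mulVec_eq_zero hdet (v := fun i => (x i : ℂ)) (by
    ext k
    have := hF' k k.isLt
    simp only [Matrix.mulVec, dotProduct, Matrix.vandermonde_apply, Pi.zero_apply]
    exact this)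
  ext i
  have := congrFun hz i
  simpa using this

lemma aux_C_mulVec (N : ℕ) (x : Fin N → ℝ) :
    (Cmat N).mulVec x = x - ((N : ℝ)⁻¹ * ∑ i, x i) • (fun _ => 1) := by
  unfold Cmat
  rw [Matrix.sub_mulVec, Matrix.one_mulVec, Matrix.smul_mulVec]
  ext j
  simp [Matrix.mulVec, dotProduct]

lemma aux_inv_mulVec {n : ℕ} (B : Matrix (Fin n) (Fin n) ℝ) (hB : IsUnit B)
    (z : Fin n → ℝ) (a : ℝ) (ha : a ≠ 0) (h : B.mulVec z = a • z) :
    B⁻¹.mulVec z = a⁻¹ • z := by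
  have h1 : B⁻¹.mulVec (B.mulVec z) = z := by
    rw [Matrix.mulVec_mulVec, Matrix.nonsing_inv_mul _ ((Matrix.isUnit_iff_isUnit_det B).1 hB),
      Matrix.one_mulVec]
  rw [h, Matrix.mulVec_smul] at h1
  rw [← h1, smul_smul, h1, inv_mul_cancel₀ ha, one_smul]

lemma aux_eval_ne {n : ℕ} (D : Matrix (Fin n) (Fin n) ℝ) (χ : ℝ) (z : Fin n → ℝ) (hz : z ≠ 0)
    (h : D.mulVec z = χ • z) (q : Polynomial ℝ) (hq : IsUnit (Polynomial.aeval D q)) :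
    q.eval χ ≠ 0 := by
  intro h0
  have h1 := aux_aeval_mulVec D χ z h q
  rw [h0, zero_smul] at h1
  apply hz
  exact Matrix.eq_zero_of_mulVec_eq_zero
    ((Matrix.isUnit_iff_isUnit_det _).1 hq).ne_zero h1

lemma aux_rat {N M : ℕ} (φ χ : ℝ) (z : Fin N → ℝ) (hz : z ≠ 0)
    (h : (Dbar N M φ).mulVec z = χ • z) (p q : Polynomial ℝ)
    (hq : IsUnit (Polynomial.aeval (Dbar N M φ) q)) :
    (ratMat N M φ p q).mulVec z = (p.eval χ * (q.eval χ)⁻¹) • z := by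
  unfold ratMat
  rw [← Matrix.mulVec_mulVec, aux_aeval_mulVec _ χ z h p, Matrix.mulVec_smul,
    aux_inv_mulVec _ hq z _ (aux_eval_ne _ χ z hz h q hq) (aux_aeval_mulVec _ χ z h q), smul_smul]

/-- Eigenvalues of the comparative-statics matrix. With `V = q(D̄)⁻¹p(D̄)`,
`A = s(D̄)⁻¹r(D̄)`, `C` the centering matrix, `q(D̄)` and `s(D̄)` invertible, and
`p(χ_k(φ)) ≠ 0` for `k = 1,…,M`: the matrix `(I−C) − CV` is invertible and, for
any `c > 0`, every eigenvector `z` of `D̄(φ)` with eigenvalue `χ` and `𝟙ᵀz = 0`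
satisfies `X z = −c (r(χ)q(χ))/(s(χ)p(χ)) z` and likewise for `C X C`. -/
theorem comparative_statics_eigenvalues (N M : ℕ) (hM : 1 ≤ M) (hN : N = 2 * M)
    (φ : ℝ) (hφ : φ ∈ Set.Ioo (0 : ℝ) 1)
    (p q r s : Polynomial ℝ)
    (hq : IsUnit (Polynomial.aeval (Dbar N M φ) q))
    (hs : IsUnit (Polynomial.aeval (Dbar N M φ) s))
    (hp : ∀ k, 1 ≤ k → k ≤ M → p.eval (chi N M k φ) ≠ 0)
    (c : ℝ) (hc : 0 < c) :
    IsUnit ((1 - Cmat N) - Cmat N * ratMat N M φ p q) ∧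
    ∀ (χ : ℝ) (z : Fin N → ℝ),
      (Dbar N M φ).mulVec z = χ • z → (∑ i, z i) = 0 →
      (Xmat N M φ p q r s c).mulVec z =
        (-(c * (r.eval χ * q.eval χ) / (s.eval χ * p.eval χ))) • z ∧
      (Cmat N * Xmat N M φ p q r s c * Cmat N).mulVec z =
        (-(c * (r.eval χ * q.eval χ) / (s.eval χ * p.eval χ))) • z := by
  subst hN
  have hNR : ((2 * M : ℕ) : ℝ) ≠ 0 := by
    have : 2 * M ≠ 0 := by omega
    exact_mod_cast this
  set D := Dbar (2 * M) M φ with hD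
  have hB : IsUnit ((1 - Cmat (2 * M)) - Cmat (2 * M) * ratMat (2 * M) M φ p q) := by
    rw [Matrix.isUnit_iff_isUnit_det, isUnit_iff_ne_zero]
    intro hdet
    obtain ⟨x, hx0, hx⟩ := Matrix.exists_mulVec_eq_zero_iff.2 hdet
    apply hx0
    set y := (ratMat (2 * M) M φ p q).mulVec x with hy
    rw [Matrix.sub_mulVec, Matrix.sub_mulVec, Matrix.one_mulVec, ← Matrix.mulVec_mulVec, ← hy,
      aux_C_mulVec, aux_C_mulVec] at hx
    have hpt : ∀ i, ((2 * M : ℕ) : ℝ)⁻¹ * ∑ i, x i - (y i - ((2 * M : ℕ) : ℝ)⁻¹ * ∑ i, y i)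
        = 0 := by
      intro i
      have := congrFun hx i
      simpa using this
    have hs0 : ∑ i, x i = 0 := by
      have h1 := Finset.sum_congr (rfl : (Finset.univ : Finset (Fin (2 * M))) = _)
        (fun i _ => hpt i)
      rw [Finset.sum_sub_distrib, Finset.sum_sub_distrib] at h1
      simp only [Finset.sum_const, Finset.card_univ, Fintype.card_fin, nsmul_eq_mul,
        mul_inv_cancel_left₀ hNR, sub_self, sub_zero, mul_zero] at h1
      exact h1
    set a : ℝ := ((2 * M : ℕ) : ℝ)⁻¹ * ∑ i, y i with ha
    have hya : y = a • (fun _ => 1) := by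
      ext i
      have := hpt i
      rw [hs0] at this
      simp only [Pi.smul_apply, smul_eq_mul, mul_one]
      linarith
    have hpq : (Polynomial.aeval D p).mulVec x = (Polynomial.aeval D q).mulVec y := by
      rw [hy]
      unfold ratMat
      rw [Matrix.mulVec_mulVec, Matrix.mul_nonsing_inv_cancel_left _ _
        ((Matrix.isUnit_iff_isUnit_det _).1 hq)]
    rw [hya, Matrix.mulVec_smul, aux_aeval_mulVec D 1 _ (aux_Dbar_one M hM φ hφ) q, smul_smul]
      at hpq
    have hsum := aux_aeval_functional D 1 (auxS (2 * M)) (aux_sum_Dbar M hM φ hφ) p x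
    have hSx : auxS (2 * M) x = 0 := hs0
    rw [hpq, map_smul, hSx, smul_zero] at hsum
    have hS1 : auxS (2 * M) (fun _ => 1) = ((2 * M : ℕ) : ℝ) := by
      simp [auxS]
    rw [hS1] at hsum
    have hzero := (smul_eq_zero.1 hsum).resolve_right hNR
    rw [hzero, zero_smul] at hpq
    exact aux_inj M hM φ hφ p hp x hs0 hpq
  refine ⟨hB, ?_⟩
  intro χ z hz hz0
  by_cases hzz : z = 0
  · subst hzz
    simp
  have hqχ := aux_eval_ne D χ z hzz hz q hq
  have hsχ := aux_eval_ne D χ z hzz hz s hs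
  have hpχ : p.eval χ ≠ 0 := by
    intro h0
    apply hzz
    apply aux_inj M hM φ hφ p hp z hz0
    rw [aux_aeval_mulVec _ χ z hz p, h0, zero_smul]
  have hC : (Cmat (2 * M)).mulVec z = z := by
    rw [aux_C_mulVec, hz0, mul_zero, zero_smul, sub_zero]
  have hBz : ((1 - Cmat (2 * M)) - Cmat (2 * M) * ratMat (2 * M) M φ p q).mulVec z
      = (-(p.eval χ * (q.eval χ)⁻¹)) • z := by
    rw [Matrix.sub_mulVec, Matrix.sub_mulVec, Matrix.one_mulVec, ← Matrix.mulVec_mulVec,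
      aux_rat φ χ z hzz hz p q hq, Matrix.mulVec_smul, hC, sub_self, zero_sub, neg_smul]
  have hBi := aux_inv_mulVec _ hB z _
    (neg_ne_zero.2 (mul_ne_zero hpχ (inv_ne_zero hqχ))) hBz
  have hX : (Xmat (2 * M) M φ p q r s c).mulVec z =
      (-(c * (r.eval χ * q.eval χ) / (s.eval χ * p.eval χ))) • z := by
    unfold Xmat
    rw [Matrix.smul_mulVec, ← Matrix.mulVec_mulVec, aux_rat φ χ z hzz hz r s hs,
      Matrix.mulVec_smul, ← Matrix.mulVec_mulVec, hC, hBi, smul_smul, smul_smul]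
    congr 1
    field_simp
  refine ⟨hX, ?_⟩
  rw [← Matrix.mulVec_mulVec, hC, ← Matrix.mulVec_mulVec, hX, Matrix.mulVec_smul, hC]
end
end
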